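/- Any online algorithm ON that has the MRU property (i.e., after serving each request its tree is an MRU tree) is 4 access-competitive: for every request sequence σ, the total access cost of ON on σ is at most 4 times the total cost (access plus adjustment) of an optimal offline algorithm OPT serving σ from the same initial configuration. -/

import Mathlib

/-!
Model: `n` items (elements of `Fin n`) are stored, one per server, on the `n`
servers of a fixed complete binary tree.  Servers are indexed in heap order by
`Fin n` (server `s` has heap index `s + 1`); the root (index `0`) has depth `0`.
A configuration is a bijection `Fin n ≃ Fin n` from items to servers; the depth
of an item is the depth of its hosting server.
-/

/-- Depth of the server with 0-based heap index `s` in the complete binary tree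
(the root, index `0`, has depth `0`). -/
def sDepth {n : ℕ} (s : Fin n) : ℕ := Nat.log 2 (s.val + 1)

/-- The parent server of `s` in the complete binary tree (the root is its own parent). -/
def sParent {n : ℕ} (s : Fin n) : Fin n :=
  ⟨(s.val + 1) / 2 - 1, by
    have h := Nat.div_le_self (s.val + 1) 2
    have h2 := s.isLt
    omega⟩

/-- Apply a list of swaps to a configuration (a bijection from items to servers):
each swap exchanges the item at the given server with the item at its parent server,
at unit cost per swap. -/
def applySwaps {n : ℕ} (l : List (Fin n)) (c : Fin n ≃ Fin n) : Fin n ≃ Fin n :=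
  l.foldl (fun c s => c.trans (Equiv.swap s (sParent s))) c

/-- The rank of item `v` at time `t` (the number of distinct items requested since the
last request to `v` prior to `t`, including `v`): upon a request to an item its rank
becomes `1`, the ranks of items with smaller rank increase by one, and all other ranks
are unchanged.  Initially the ranks are induced by the bijection `r0`
(`itemRank r0 σ 0 v = r0 v + 1`, a permutation of `1, …, n`). -/
def itemRank {n : ℕ} (r0 : Fin n ≃ Fin n) (σ : ℕ → Fin n) : ℕ → Fin n → ℕ
  | 0 => fun v => (r0 v).val + 1
  | t + 1 => fun v =>
      if v = σ t then 1
      else if itemRank r0 σ t v < itemRank r0 σ t (σ t) then itemRank r0 σ t v + 1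
      else itemRank r0 σ t v

open Finset in
/-- The number of items that are ranked before `v` but lie strictly deeper than `v`. -/
def inversions {n : ℕ} (r d : Fin n → ℕ) (v : Fin n) : ℕ :=
  #{w | r w < r v ∧ d v < d w}

/-- The potential function of the amortized analysis. -/
noncomputable def potential {n : ℕ} (r d : Fin n → ℕ) : ℝ :=
  ∑ v, Real.log (1 + (inversions r d v : ℝ) / 2 ^ d v)

theorem potential_nonneg {n : ℕ} (r d : Fin n → ℕ) : 0 ≤ potential r d :=
  Finset.sum_nonneg fun v _ => Real.log_nonneg (by
    have : (0 : ℝ) ≤ (inversions r d v : ℝ) / 2 ^ d v := by positivity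
    linarith)

theorem potential_log_two {n : ℕ} (r : Fin n → ℕ) :
    potential r (fun v => Nat.log 2 (r v)) = 0 := by
  refine Finset.sum_eq_zero fun v _ => ?_
  have h : inversions r (fun v => Nat.log 2 (r v)) v = 0 := by
    refine Finset.card_eq_zero.2 (Finset.filter_eq_empty_iff.2 ?_)
    rintro w - ⟨h₁, h₂⟩
    exact absurd (Nat.log_mono_right (b := 2) h₁.le) (not_le.2 h₂)
  simp [h]

open Finset in
theorem card_depth_eq_le {n : ℕ} (c : Fin n ≃ Fin n) (j : ℕ) :
    #{v | sDepth (c v) = j} ≤ 2 ^ j := by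
  have h : #{v | sDepth (c v) = j} ≤ #(Ico (2 ^ j) (2 ^ (j + 1))) := by
    refine card_le_card_of_injOn (fun v => (c v).val + 1) ?_ ?_
    · intro v hv
      have hv : Nat.log 2 ((c v).val + 1) = j := (mem_filter.1 (mem_coe.1 hv)).2
      simpa using (Nat.log_eq_iff (Or.inr ⟨by norm_num, by omega⟩)).1 hv
    · intro v _ w _ h
      exact c.injective (Fin.ext (by simpa using h))
  refine h.trans ?_
  rw [Nat.card_Ico, pow_succ]
  omega

open Finset in
theorem card_depth_le_lt {n : ℕ} (c : Fin n ≃ Fin n) (j : ℕ) :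
    #{v | sDepth (c v) ≤ j} < 2 ^ (j + 1) := by
  have h : #{v | sDepth (c v) ≤ j} ≤ #(Ico 1 (2 ^ (j + 1))) := by
    refine card_le_card_of_injOn (fun v => (c v).val + 1) ?_ ?_
    · intro v hv
      have hv : Nat.log 2 ((c v).val + 1) ≤ j := (mem_filter.1 (mem_coe.1 hv)).2
      simpa using Nat.lt_pow_of_log_lt (by norm_num) (Nat.lt_succ_of_le hv)
    · intro v _ w _ h
      exact c.injective (Fin.ext (by simpa using h))
  have := Nat.two_pow_pos (j + 1)
  rw [Nat.card_Ico] at h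
  omega

open Finset in
theorem two_pow_le_card_depth_lt {n : ℕ} (c : Fin n ≃ Fin n) (x : Fin n) :
    2 ^ sDepth (c x) ≤ #{v | sDepth (c v) < sDepth (c x)} + 1 := by
  have hx : 2 ^ sDepth (c x) ≤ (c x).val + 1 := Nat.pow_log_le_self 2 (by omega)
  have hlt := (c x).isLt
  have h : #(range (2 ^ sDepth (c x) - 1)) ≤ #{v | sDepth (c v) < sDepth (c x)} := by
    refine card_le_card_of_surjOn (fun v => (c v).val) ?_
    intro i hi
    have hi : i < 2 ^ sDepth (c x) - 1 := by simpa using hi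
    refine ⟨c.symm ⟨i, by omega⟩, ?_, by simp⟩
    simp only [coe_filter, mem_univ, true_and, Set.mem_ofPred_eq, Equiv.apply_symm_apply]
    exact Nat.log_lt_of_lt_pow (by simp) (by simp only; omega)
  rw [card_range] at h
  omega

theorem sum_depth_eq_weight_le {n : ℕ} (c : Fin n ≃ Fin n) (j : ℕ) :
    ∑ v, (if sDepth (c v) = j then 1 / (2 : ℝ) ^ sDepth (c v) else 0) ≤ 1 := by
  rw [← Finset.sum_filter, Finset.sum_congr rfl (g := fun _ => 1 / (2 : ℝ) ^ j)
    (fun v hv => by rw [(Finset.mem_filter.1 hv).2]), Finset.sum_const, nsmul_eq_mul,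
    mul_one_div, div_le_one (by positivity)]
  exact_mod_cast card_depth_eq_le c j

theorem sum_depth_lt_weight_le {n : ℕ} (c : Fin n ≃ Fin n) (j : ℕ) :
    ∑ v, (if sDepth (c v) < j then 1 / (2 : ℝ) ^ sDepth (c v) else 0) ≤ j := by
  induction j with
  | zero => simp
  | succ j ih =>
    have h := sum_depth_eq_weight_le c j
    have heq : ∀ v, (if sDepth (c v) < j + 1 then 1 / (2 : ℝ) ^ sDepth (c v) else 0)
        = (if sDepth (c v) < j then 1 / (2 : ℝ) ^ sDepth (c v) else 0)
          + (if sDepth (c v) = j then 1 / (2 : ℝ) ^ sDepth (c v) else 0) := by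
      intro v
      rcases lt_trichotomy (sDepth (c v)) j with h | h | h
      · rw [if_pos (by omega), if_pos h, if_neg (by omega), add_zero]
      · rw [if_pos (by omega), if_neg (by omega), if_pos h, zero_add]
      · rw [if_neg (by omega), if_neg (by omega), if_neg (by omega), add_zero]
    rw [Finset.sum_congr rfl fun v _ => heq v, Finset.sum_add_distrib]
    push_cast
    linarith

theorem log_one_add_div_le_of_le {a a' k k' : ℕ} (ha : a' ≤ a) (hk : k ≤ k') :
    Real.log (1 + (a' : ℝ) / 2 ^ k') ≤ Real.log (1 + (a : ℝ) / 2 ^ k) := by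
  have : (a : ℝ) ≥ a' := by exact_mod_cast ha
  refine Real.log_le_log (by positivity) ?_
  gcongr
  norm_num

theorem log_one_add_div_le_of_le_succ {a a' k k' : ℕ} (ha : a' ≤ a + 1) (hk : k ≤ k') :
    Real.log (1 + (a' : ℝ) / 2 ^ k') ≤ Real.log (1 + (a : ℝ) / 2 ^ k) + 1 / 2 ^ k := by
  refine (log_one_add_div_le_of_le ha hk).trans ?_
  have h₁ : (1 : ℝ) + ((a + 1 : ℕ) : ℝ) / 2 ^ k
      ≤ (1 + (a : ℝ) / 2 ^ k) * (1 + 1 / 2 ^ k) := by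
    have : (0 : ℝ) ≤ (a : ℝ) / 2 ^ k * (1 / 2 ^ k) := by positivity
    push_cast
    rw [add_div]
    linarith
  refine (Real.log_le_log (by positivity) h₁).trans ?_
  rw [Real.log_mul (by positivity) (by positivity)]
  have := Real.log_le_sub_one_of_pos (show (0 : ℝ) < 1 + 1 / 2 ^ k by positivity)
  linarith

theorem log_one_add_div_le_of_rise {a a' k : ℕ} (ha : a' ≤ a + 2 ^ (k + 1)) :
    Real.log (1 + (a' : ℝ) / 2 ^ k) ≤ Real.log (1 + (a : ℝ) / 2 ^ (k + 1)) + 2 * Real.log 2 := by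
  have ha' : (a' : ℝ) ≤ a + 2 ^ (k + 1) := by exact_mod_cast ha
  have h : (1 : ℝ) + (a' : ℝ) / 2 ^ k ≤ (1 + (a : ℝ) / 2 ^ (k + 1)) * 2 ^ 2 := by
    have h₁ : (a' : ℝ) / 2 ^ k ≤ (a + 2 ^ (k + 1)) / 2 ^ k := by gcongr
    have h₂ : ((a : ℝ) + 2 ^ (k + 1)) / 2 ^ k = 2 * ((a : ℝ) / 2 ^ (k + 1)) + 2 := by
      field_simp
      ring
    have h₃ : (0 : ℝ) ≤ (a : ℝ) / 2 ^ (k + 1) := by positivity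
    linarith
  refine (Real.log_le_log (by positivity) h).trans ?_
  rw [Real.log_mul (by positivity) (by positivity), Real.log_pow]
  norm_num

theorem half_lt_log_two : 1 / 2 < Real.log 2 := by
  have := Real.log_two_gt_d9
  linarith

theorem sDepth_eq_sDepth_sParent_add_one {n : ℕ} {s : Fin n} (hs : s ≠ sParent s) :
    sDepth s = sDepth (sParent s) + 1 := by
  have hs0 : s.val ≠ 0 := fun h => hs (Fin.ext (by simp [sParent, h]))
  have h : (s.val + 1) / 2 - 1 + 1 = (s.val + 1) / 2 := by omega
  simp only [sDepth, sParent, h]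
  exact Nat.log_of_one_lt_of_le (by norm_num) (by omega)

open Finset in
/-- A single swap raises the potential by at most `4 log 2`. -/
theorem potential_swap_le {n : ℕ} (r : Fin n → ℕ) (c : Fin n ≃ Fin n) (s : Fin n) :
    potential r (fun v => sDepth (c.trans (Equiv.swap s (sParent s)) v))
      ≤ potential r (fun v => sDepth (c v)) + 4 * Real.log 2 := by
  by_cases hs : s = sParent s
  · rw [← hs, Equiv.swap_self]
    have := half_lt_log_two
    simp only [Equiv.trans_refl]
    linarith
  set c' := c.trans (Equiv.swap s (sParent s)) with hc'
  set d : Fin n → ℕ := fun v => sDepth (c v) with hd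
  set d' : Fin n → ℕ := fun v => sDepth (c' v) with hd'
  set J := sDepth (sParent s)
  have hJ : sDepth s = J + 1 := sDepth_eq_sDepth_sParent_add_one hs
  set u := c.symm s with hu
  set p := c.symm (sParent s) with hp
  have hdu : d u = J + 1 := by simp [hd, hu, hJ]
  have hdp : d p = J := by simp [hd, hp, J]
  have hdu' : d' u = J := by simp [hd', hc', hu, J]
  have hdp' : d' p = J + 1 := by simp [hd', hc', hp, hJ]
  have hdo : ∀ v, v ≠ u → v ≠ p → d' v = d v := by
    intro v h₁ h₂
    have h₁' : c v ≠ s := fun h => h₁ (by simp [hu, ← h])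
    have h₂' : c v ≠ sParent s := fun h => h₂ (by simp [hp, ← h])
    simp [hd, hd', hc', Equiv.swap_apply_of_ne_of_ne h₁' h₂']
  have hle : ∀ v, v ≠ u → d v ≤ d' v := by
    intro v hv
    by_cases hvp : v = p
    · rw [hvp, hdp, hdp']; omega
    · exact (hdo v hv hvp).ge
  have hge : ∀ v, v ≠ p → d' v ≤ d v := by
    intro v hv
    by_cases hvu : v = u
    · rw [hvu, hdu, hdu']; omega
    · exact (hdo v hvu hv).le
  have key : ∀ v, Real.log (1 + (inversions r d' v : ℝ) / 2 ^ d' v)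
      ≤ Real.log (1 + (inversions r d v : ℝ) / 2 ^ d v)
        + ((if v = u then 2 * Real.log 2 else 0) + (if d v = J then 1 / 2 ^ d v else 0)) := by
    intro v
    by_cases hv : v = u
    · subst hv
      rw [if_pos rfl, if_neg (by omega), add_zero, hdu, hdu']
      refine log_one_add_div_le_of_rise ?_
      have hsub : (univ.filter fun w => r w < r u ∧ d' u < d' w)
          ⊆ (univ.filter fun w => r w < r u ∧ d u < d w)
            ∪ (univ.filter fun w => sDepth (c' w) = J + 1) := by
        intro w hw
        simp only [mem_filter, mem_univ, true_and, mem_union] at hw ⊢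
        by_cases hwJ : d' w = J + 1
        · exact Or.inr hwJ
        · refine Or.inl ⟨hw.1, ?_⟩
          have := hge w (fun h => hwJ (h ▸ hdp'))
          omega
      exact (card_le_card hsub).trans ((card_union_le _ _).trans
        (Nat.add_le_add_left (card_depth_eq_le c' (J + 1)) _))
    · rw [if_neg hv, zero_add]
      by_cases hvJ : d v = J
      · rw [if_pos hvJ]
        refine log_one_add_div_le_of_le_succ ?_ (hle v hv)
        refine le_trans (card_le_card ?_) (card_insert_le p _)
        intro w hw
        simp only [mem_filter, mem_univ, true_and, mem_insert] at hw ⊢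
        by_cases hwp : w = p
        · exact Or.inl hwp
        · exact Or.inr ⟨hw.1, (hle v hv).trans_lt (hw.2.trans_le (hge w hwp))⟩
      · rw [if_neg hvJ, add_zero]
        refine log_one_add_div_le_of_le (card_le_card ?_) (hle v hv)
        intro w hw
        simp only [mem_filter, mem_univ, true_and] at hw ⊢
        refine ⟨hw.1, ?_⟩
        have h₁ := hle v hv
        by_cases hwp : w = p
        · subst hwp
          omega
        · exact h₁.trans_lt (hw.2.trans_le (hge w hwp))
  have hsum := sum_le_sum fun v (_ : v ∈ univ) => key v
  rw [sum_add_distrib, sum_add_distrib, sum_ite_eq' univ u, if_pos (mem_univ u)] at hsum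
  have hw := sum_depth_eq_weight_le c J
  have := half_lt_log_two
  unfold potential
  linarith

theorem potential_applySwaps_le {n : ℕ} (r : Fin n → ℕ) (l : List (Fin n)) (c : Fin n ≃ Fin n) :
    potential r (fun v => sDepth (applySwaps l c v))
      ≤ potential r (fun v => sDepth (c v)) + 4 * Real.log 2 * l.length := by
  induction l generalizing c with
  | nil => simp [applySwaps]
  | cons s l ih =>
    have h₁ := ih (c.trans (Equiv.swap s (sParent s)))
    have h₂ := potential_swap_le r c s
    have h₃ : applySwaps (s :: l) c = applySwaps l (c.trans (Equiv.swap s (sParent s))) := rfl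
    rw [h₃, List.length_cons]
    push_cast
    linarith

theorem one_le_itemRank {n : ℕ} (r0 : Fin n ≃ Fin n) (σ : ℕ → Fin n) (t : ℕ) (v : Fin n) :
    1 ≤ itemRank r0 σ t v := by
  induction t with
  | zero => simp [itemRank]
  | succ t ih =>
    simp only [itemRank]
    split_ifs <;> omega

theorem itemRank_lt_of_itemRank_succ_lt {n : ℕ} {r0 : Fin n ≃ Fin n} {σ : ℕ → Fin n} {t : ℕ}
    {v w : Fin n} (hv : v ≠ σ t) (hw : w ≠ σ t)
    (h : itemRank r0 σ (t + 1) w < itemRank r0 σ (t + 1) v) :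
    itemRank r0 σ t w < itemRank r0 σ t v := by
  simp only [itemRank, if_neg hv, if_neg hw] at h
  split_ifs at h <;> omega

open Finset in
/-- If the item `x` is at depth `k` in an MRU tree for `r`, then its contribution to the potential
together with its depth in `c` pays for `k`. -/
theorem depth_mul_log_two_le {n : ℕ} (r : Fin n → ℕ) (e c : Fin n ≃ Fin n) (x : Fin n)
    (he : ∀ v, sDepth (e v) = Nat.log 2 (r v)) :
    (sDepth (e x) : ℝ) * Real.log 2 + sDepth (c x)
      ≤ Real.log (1 + (inversions r (fun v => sDepth (c v)) x : ℝ) / 2 ^ sDepth (c x))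
        + 4 * Real.log 2 * sDepth (c x) := by
  set d : Fin n → ℕ := fun v => sDepth (c v) with hd
  set b := inversions r d x with hb
  set k := sDepth (e x) with hk
  have hcount : 2 ^ k + 1 ≤ b + 2 ^ (d x + 1) := by
    have h₁ : 2 ^ k ≤ #{v | sDepth (e v) < k} + 1 := two_pow_le_card_depth_lt e x
    have h₂ : #{v | d v ≤ d x} < 2 ^ (d x + 1) := card_depth_le_lt c (d x)
    have hsub : (univ.filter fun v => sDepth (e v) < k)
        ⊆ (univ.filter fun v => r v < r x ∧ d x < d v)
          ∪ (univ.filter fun v => d v ≤ d x).erase x := by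
      intro v hv
      simp only [mem_filter, mem_univ, true_and, mem_union, mem_erase] at hv ⊢
      by_cases h : d v ≤ d x
      · exact Or.inr ⟨fun hvx => by simp [hvx, hk] at hv, h⟩
      · refine Or.inl ⟨?_, not_le.1 h⟩
        rw [he, hk, he] at hv
        exact lt_of_not_ge fun h => absurd (Nat.log_mono_right (b := 2) h) (not_le.2 hv)
    have h₃ := (card_le_card hsub).trans (card_union_le _ _)
    have hx : x ∈ univ.filter fun v => d v ≤ d x := by simp
    have h₄ := card_erase_add_one hx
    have h₅ : #{v | r v < r x ∧ d x < d v} = b := rfl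
    omega
  change (k : ℝ) * Real.log 2 + (d x : ℝ)
    ≤ Real.log (1 + (b : ℝ) / 2 ^ d x) + 4 * Real.log 2 * (d x : ℝ)
  have hl := half_lt_log_two
  generalize d x = D at hcount ⊢
  have hR : (2 : ℝ) ^ k + 1 ≤ b + 2 ^ (D + 1) := by exact_mod_cast hcount
  rcases Nat.eq_zero_or_pos D with rfl | hD
  · have : (2 : ℝ) ^ k ≤ 1 + b / 2 ^ 0 := by
      norm_num at hR ⊢
      linarith
    have := Real.log_le_log (by positivity) this
    rw [Real.log_pow] at this
    simpa using this
  have hD' : (1 : ℝ) ≤ D := by exact_mod_cast hD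
  have hmain : (k : ℝ) * Real.log 2
      ≤ Real.log (1 + (b : ℝ) / 2 ^ D) + (D + 1) * Real.log 2 := by
    have hpow : (2 : ℝ) ^ k ≤ (1 + (b : ℝ) / 2 ^ D) * 2 ^ (D + 1) := by
      have h : (1 + (b : ℝ) / 2 ^ D) * 2 ^ (D + 1) = 2 ^ (D + 1) + 2 * b := by
        field_simp
        ring
      rw [h]
      have : (0 : ℝ) ≤ b := by positivity
      linarith
    have := Real.log_le_log (by positivity) hpow
    rw [Real.log_mul (by positivity) (by positivity), Real.log_pow, Real.log_pow] at this
    exact_mod_cast this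
  nlinarith

open Finset in
/-- The amortized cost of the access at time `t`, before the offline swaps. -/
theorem potential_itemRank_succ_le {n : ℕ} (r0 : Fin n ≃ Fin n) (σ : ℕ → Fin n) (t : ℕ)
    (e c : Fin n ≃ Fin n) (he : ∀ v, sDepth (e v) = Nat.log 2 (itemRank r0 σ t v)) :
    potential (itemRank r0 σ (t + 1)) (fun v => sDepth (c v))
        + (sDepth (e (σ t)) : ℝ) * Real.log 2
      ≤ potential (itemRank r0 σ t) (fun v => sDepth (c v))
        + 4 * Real.log 2 * sDepth (c (σ t)) := by
  have hx := depth_mul_log_two_le (itemRank r0 σ t) e c (σ t) he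
  set x := σ t with hxdef
  set d : Fin n → ℕ := fun v => sDepth (c v) with hd
  have key : ∀ v, Real.log (1 + (inversions (itemRank r0 σ (t + 1)) d v : ℝ) / 2 ^ d v)
      ≤ (Real.log (1 + (inversions (itemRank r0 σ t) d v : ℝ) / 2 ^ d v)
        - (if v = x then Real.log (1 + (inversions (itemRank r0 σ t) d x : ℝ) / 2 ^ d x) else 0))
        + (if d v < d x then 1 / 2 ^ d v else 0) := by
    intro v
    by_cases hv : v = x
    · subst hv
      have h : inversions (itemRank r0 σ (t + 1)) d x = 0 := by
        refine card_eq_zero.2 (filter_eq_empty_iff.2 ?_)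
        rintro w - ⟨h, -⟩
        have h₁ := one_le_itemRank r0 σ (t + 1) w
        have h₂ : itemRank r0 σ (t + 1) x = 1 := by simp [itemRank, hxdef]
        omega
      simp [h]
    · rw [if_neg hv, sub_zero]
      by_cases hvx : d v < d x
      · rw [if_pos hvx]
        refine log_one_add_div_le_of_le_succ ?_ le_rfl
        refine le_trans (card_le_card ?_) (card_insert_le x _)
        intro w hw
        simp only [mem_filter, mem_univ, true_and, mem_insert] at hw ⊢
        by_cases hwx : w = x
        · exact Or.inl hwx
        · exact Or.inr ⟨itemRank_lt_of_itemRank_succ_lt hv hwx hw.1, hw.2⟩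
      · rw [if_neg hvx, add_zero]
        refine log_one_add_div_le_of_le (card_le_card ?_) le_rfl
        intro w hw
        simp only [mem_filter, mem_univ, true_and] at hw ⊢
        have hwx : w ≠ x := fun h => hvx (h ▸ hw.2)
        exact ⟨itemRank_lt_of_itemRank_succ_lt hv hwx hw.1, hw.2⟩
  have hsum := sum_le_sum fun v (_ : v ∈ univ) => key v
  rw [sum_add_distrib, sum_sub_distrib, sum_ite_eq' univ x, if_pos (mem_univ x)] at hsum
  have hw := sum_depth_lt_weight_le c (d x)
  unfold potential
  change _ ≤ _ + 4 * Real.log 2 * (d x : ℝ)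
  change _ + (d x : ℝ) ≤ Real.log (1 + _ / 2 ^ d x) + 4 * Real.log 2 * (d x : ℝ) at hx
  linarith

/-- Any online algorithm `ON` that has the MRU property — i.e. at every time `t` the tree
maintained by `ON` is an MRU tree: every item `v` is at depth `⌊log₂ (rank of v)⌋` —
is `4` access-competitive: its total access cost on `σ` is at most `4` times the total
cost (access plus one per swap) of any offline algorithm (in particular of an optimal
offline algorithm `OPT`) serving `σ` from the same initial configuration. -/
theorem mru_is_four_access_competitive
    (K : ℕ) (hK : 1 ≤ K) (n : ℕ) (hn : n = 2 ^ K - 1)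
    (r0 : Fin n ≃ Fin n) (σ : ℕ → Fin n) (m : ℕ)
    (onConf : ℕ → (Fin n ≃ Fin n))
    (hMRU : ∀ t, ∀ v : Fin n, sDepth (onConf t v) = Nat.log 2 (itemRank r0 σ t v))
    (optConf : ℕ → (Fin n ≃ Fin n)) (optSwaps : ℕ → List (Fin n))
    (hsame : optConf 0 = onConf 0)
    (hstep : ∀ t, optConf (t + 1) = applySwaps (optSwaps t) (optConf t)) :
    ∑ t ∈ Finset.range m, sDepth (onConf t (σ t))
      ≤ 4 * ∑ t ∈ Finset.range m,
          (sDepth (optConf t (σ t)) + (optSwaps t).length) := by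
  have main : ∀ m : ℕ, potential (itemRank r0 σ m) (fun v => sDepth (optConf m v))
      + (∑ t ∈ Finset.range m, (sDepth (onConf t (σ t)) : ℝ)) * Real.log 2
      ≤ 4 * Real.log 2 * ∑ t ∈ Finset.range m,
          ((sDepth (optConf t (σ t)) : ℝ) + (optSwaps t).length) := by
    intro m
    induction m with
    | zero =>
      have h : (fun v => sDepth (optConf 0 v)) = fun v => Nat.log 2 (itemRank r0 σ 0 v) := by
        funext v
        rw [hsame, hMRU]
      rw [h, potential_log_two]
      simp
    | succ m ih =>
      have h₁ := potential_itemRank_succ_le r0 σ m (onConf m) (optConf m) (hMRU m)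
      have h₂ := potential_applySwaps_le (itemRank r0 σ (m + 1)) (optSwaps m) (optConf m)
      rw [← hstep] at h₂
      rw [Finset.sum_range_succ, Finset.sum_range_succ, add_mul, mul_add (4 * Real.log 2),
        mul_add (4 * Real.log 2)]
      linarith
  have hm := main m
  have hpot := potential_nonneg (itemRank r0 σ m) (fun v => sDepth (optConf m v))
  have hl := half_lt_log_two
  have hfinal : ∑ t ∈ Finset.range m, (sDepth (onConf t (σ t)) : ℝ)
      ≤ 4 * ∑ t ∈ Finset.range m,
          ((sDepth (optConf t (σ t)) : ℝ) + (optSwaps t).length) := by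
    refine le_of_mul_le_mul_right ?_ (show 0 < Real.log 2 by linarith)
    linarith
  exact_mod_cast hfinal
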